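/- arXiv:1604.00274 — 8 statements merged into one kernel-verified Lean document; each statement's English description precedes it below -/
import Mathlib

section
/- Let N_A, N_B ≥ 2 be natural numbers, let λ be a real number with 0 ≤ λ < 1, let t_A, t_B be natural numbers with 0 < t_A < N_A and 0 < t_B < N_B, and let γ be a real number with 1−λ ≤ γ ≤ 1/(1−λ). Then (1−γ(1−λ))·min(t_A, N_B−t_B) + (1−(1−λ)/γ)·min(N_A−t_A, t_B) < min(N_A, N_B). (Consequently, the achievable degrees-of-freedom region of the antenna-conserved full-duplex two way channel lies strictly inside the half-duplex region whenever self-interference cancellation is imperfect.) -/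
/-- For the two way channel with imperfect self-interference cancellation (λ < 1),
any achievable antenna-conserved full-duplex DoF pair has sum strictly less than
`min N_A N_B`, so the AC FD DoF region lies strictly inside the HD region. -/
theorem stmt_0 (N_A N_B t_A t_B : ℕ) (hNA : 2 ≤ N_A) (hNB : 2 ≤ N_B)
    (l : ℝ) (hl0 : 0 ≤ l) (hl1 : l < 1)
    (htA0 : 0 < t_A) (htA : t_A < N_A) (htB0 : 0 < t_B) (htB : t_B < N_B)
    (γ : ℝ) (hγl : 1 - l ≤ γ) (hγu : γ ≤ 1 / (1 - l)) :
    (1 - γ * (1 - l)) * min (t_A : ℝ) ((N_B : ℝ) - t_B)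
      + (1 - (1 - l) / γ) * min ((N_A : ℝ) - t_A) (t_B : ℝ)
      < min (N_A : ℝ) (N_B : ℝ) := by
  have hc : 0 < 1 - l := sub_pos.2 hl1
  have hγ : 0 < γ := hc.trans_le hγl
  have hA : (t_A : ℝ) < N_A := by exact_mod_cast htA
  have hB : (t_B : ℝ) < N_B := by exact_mod_cast htB
  have hx : 0 < min (t_A : ℝ) ((N_B : ℝ) - t_B) :=
    lt_min (by exact_mod_cast htA0) (sub_pos.2 hB)
  have hy : 0 < min ((N_A : ℝ) - t_A) (t_B : ℝ) :=
    lt_min (sub_pos.2 hA) (by exact_mod_cast htB0)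
  have hsum : min (t_A : ℝ) ((N_B : ℝ) - t_B) + min ((N_A : ℝ) - t_A) (t_B : ℝ)
      ≤ min (N_A : ℝ) (N_B : ℝ) :=
    le_min
      (by linarith [min_le_left (t_A : ℝ) ((N_B : ℝ) - t_B),
        min_le_left ((N_A : ℝ) - t_A) (t_B : ℝ)])
      (by linarith [min_le_right (t_A : ℝ) ((N_B : ℝ) - t_B),
        min_le_right ((N_A : ℝ) - t_A) (t_B : ℝ)])
  linarith [mul_pos (mul_pos hγ hc) hx, mul_pos (div_pos hc hγ) hy]
end

section
/- Let N, N_R be positive natural numbers with N_R even, and let λ be a real number with 0 ≤ λ ≤ 1. Then taking r = N_R/2 and γ = 1/(2−λ) gives min((1−γ(1−λ))·N, (1−γ(1−λ))·r, γ·(N_R−r), γ·N) = (1/(2−λ))·min(N, N_R/2). In particular the supremum over integers 1 ≤ r ≤ N_R−1 and reals γ ∈ (0,1] of min((1−γ(1−λ))·N, (1−γ(1−λ))·r, γ·(N_R−r), γ·N) is at least (1/(2−λ))·min(N, N_R/2). -/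
/-- Antenna-conserved full-duplex relaying, symmetric case: with r = N_R/2 and
γ = 1/(2−λ), the DoF expression equals (1/(2−λ))·min(N, N_R/2); hence the
achievable full-duplex relaying DoF is at least this value. -/
theorem stmt_10 (N N_R : ℕ) (hN : 0 < N) (hR : 0 < N_R) (heven : Even N_R)
    (l : ℝ) (hl0 : 0 ≤ l) (hl1 : l ≤ 1) :
    (min (min ((1 - (1 / (2 - l)) * (1 - l)) * N)
              ((1 - (1 / (2 - l)) * (1 - l)) * ((N_R : ℝ) / 2)))
         (min ((1 / (2 - l)) * ((N_R : ℝ) - (N_R : ℝ) / 2)) ((1 / (2 - l)) * N))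
      = (1 / (2 - l)) * min (N : ℝ) ((N_R : ℝ) / 2)) ∧
    (∃ r : ℕ, 1 ≤ r ∧ r ≤ N_R - 1 ∧ ∃ γ ∈ Set.Ioc (0 : ℝ) 1,
      (1 / (2 - l)) * min (N : ℝ) ((N_R : ℝ) / 2)
        ≤ min (min ((1 - γ * (1 - l)) * N) ((1 - γ * (1 - l)) * r))
              (min (γ * ((N_R : ℝ) - r)) (γ * N))) := by
  have hpos : 0 < 2 - l := by linarith
  have hγ : 1 - (1 / (2 - l)) * (1 - l) = 1 / (2 - l) := by
    field_simp
    ring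
  have hnonneg : 0 ≤ 1 / (2 - l) := by positivity
  have hvalue : min (min ((1 - (1 / (2 - l)) * (1 - l)) * N)
              ((1 - (1 / (2 - l)) * (1 - l)) * ((N_R : ℝ) / 2)))
         (min ((1 / (2 - l)) * ((N_R : ℝ) - (N_R : ℝ) / 2)) ((1 / (2 - l)) * N))
      = (1 / (2 - l)) * min (N : ℝ) ((N_R : ℝ) / 2) := by
    rw [hγ, sub_half, ← mul_min_of_nonneg _ _ hnonneg, ← mul_min_of_nonneg _ _ hnonneg,
      min_comm ((N_R : ℝ) / 2), min_self]
  refine ⟨hvalue, ?_⟩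
  obtain ⟨m, rfl⟩ := heven
  have hm : (m : ℝ) = ((m + m : ℕ) : ℝ) / 2 := by
    push_cast
    ring
  refine ⟨m, by omega, by omega, 1 / (2 - l), ⟨by positivity, ?_⟩, ?_⟩
  · rw [div_le_one hpos]
    linarith
  · rw [hm]
    exact hvalue.ge
end

section
/- Let N, N_R be positive natural numbers and let λ be a real number with 0 ≤ λ ≤ 1. Then for every integer r with 1 ≤ r ≤ N_R−1 and every real γ ∈ (0,1], min((1−γ(1−λ))·N, (1−γ(1−λ))·r, γ·(N_R−r), γ·N) ≤ N/(2−λ). Hence the achievable full-duplex relaying degrees of freedom are at most N/(2−λ). -/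
/-- Antenna-conserved full-duplex relaying, symmetric case, upper bound: for every
admissible antenna split r and power scaling γ ∈ (0,1], the DoF expression is at
most N/(2−λ). -/
theorem stmt_11 (N N_R : ℕ) (hN : 0 < N) (hR : 0 < N_R)
    (l : ℝ) (hl0 : 0 ≤ l) (hl1 : l ≤ 1) :
    ∀ r : ℕ, 1 ≤ r → r ≤ N_R - 1 → ∀ γ ∈ Set.Ioc (0 : ℝ) 1,
      min (min ((1 - γ * (1 - l)) * N) ((1 - γ * (1 - l)) * r))
          (min (γ * ((N_R : ℝ) - r)) (γ * N)) ≤ (N : ℝ) / (2 - l) := by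
  intro r _ _ γ _
  rw [le_div_iff₀ (by linarith)]
  set m := min (min ((1 - γ * (1 - l)) * N) ((1 - γ * (1 - l)) * r))
    (min (γ * ((N_R : ℝ) - r)) (γ * N))
  have source_bound : m ≤ (1 - γ * (1 - l)) * N :=
    (min_le_left _ _).trans (min_le_left _ _)
  have destination_bound : m ≤ γ * N := (min_le_right _ _).trans (min_le_right _ _)
  have weighted_bound : (1 - l) * m ≤ (1 - l) * (γ * N) :=
    mul_le_mul_of_nonneg_left destination_bound (sub_nonneg.2 hl1)
  linarith
end

section
/- Let N, N_R be positive natural numbers with N_R ≥ 2, and let λ be a real number with 0 ≤ λ ≤ 1. Then taking r = ⌊2N_R/3⌋ and γ = 1/(2−λ) gives min((1−γ(1−λ))·N, (1−γ(1−λ))·r, γ·(2N_R−2r), γ·N) = (1/(2−λ))·min(N, ⌊2N_R/3⌋). In particular the supremum over integers 1 ≤ r ≤ N_R−1 and reals γ ∈ (0,1] of min((1−γ(1−λ))·N, (1−γ(1−λ))·r, γ·(2N_R−2r), γ·N) is at least (1/(2−λ))·min(N, ⌊2N_R/3⌋). -/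
/-- RF-chain-conserved full-duplex relaying, symmetric case: with r = ⌊2N_R/3⌋ and
γ = 1/(2−λ), the DoF expression equals (1/(2−λ))·min(N, ⌊2N_R/3⌋); hence the
achievable full-duplex relaying DoF is at least this value. -/
theorem stmt_12 (N N_R : ℕ) (hN : 0 < N) (hR : 2 ≤ N_R)
    (l : ℝ) (hl0 : 0 ≤ l) (hl1 : l ≤ 1) :
    (min (min ((1 - (1 / (2 - l)) * (1 - l)) * N)
              ((1 - (1 / (2 - l)) * (1 - l)) * ((2 * N_R / 3 : ℕ) : ℝ)))
         (min ((1 / (2 - l)) * (2 * (N_R : ℝ) - 2 * ((2 * N_R / 3 : ℕ) : ℝ)))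
              ((1 / (2 - l)) * N))
      = (1 / (2 - l)) * min (N : ℝ) ((2 * N_R / 3 : ℕ) : ℝ)) ∧
    (∃ r : ℕ, 1 ≤ r ∧ r ≤ N_R - 1 ∧ ∃ γ ∈ Set.Ioc (0 : ℝ) 1,
      (1 / (2 - l)) * min (N : ℝ) ((2 * N_R / 3 : ℕ) : ℝ)
        ≤ min (min ((1 - γ * (1 - l)) * N) ((1 - γ * (1 - l)) * r))
              (min (γ * (2 * (N_R : ℝ) - 2 * r)) (γ * N))) := by
  have hc : 1 - 1 / (2 - l) * (1 - l) = 1 / (2 - l) := by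
    have : 2 - l ≠ 0 := by linarith
    field_simp
    ring
  have hpos : 0 < 1 / (2 - l) := one_div_pos.mpr (by linarith)
  have hfloor : ((2 * N_R / 3 : ℕ) : ℝ) ≤ 2 * (N_R : ℝ) - 2 * ((2 * N_R / 3 : ℕ) : ℝ) := by
    have h : 3 * (2 * N_R / 3) ≤ 2 * N_R := Nat.mul_div_le _ _
    have h' : 3 * ((2 * N_R / 3 : ℕ) : ℝ) ≤ 2 * N_R := by exact_mod_cast h
    linarith
  have heq : min (min ((1 - (1 / (2 - l)) * (1 - l)) * N)
              ((1 - (1 / (2 - l)) * (1 - l)) * ((2 * N_R / 3 : ℕ) : ℝ)))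
         (min ((1 / (2 - l)) * (2 * (N_R : ℝ) - 2 * ((2 * N_R / 3 : ℕ) : ℝ)))
              ((1 / (2 - l)) * N))
      = (1 / (2 - l)) * min (N : ℝ) ((2 * N_R / 3 : ℕ) : ℝ) := by
    rw [hc, ← mul_min_of_nonneg _ _ hpos.le, ← mul_min_of_nonneg _ _ hpos.le,
      ← mul_min_of_nonneg _ _ hpos.le]
    congr 1
    exact min_eq_left (le_min ((min_le_right _ _).trans hfloor) (min_le_left _ _))
  exact ⟨heq, 2 * N_R / 3, by omega, by omega, 1 / (2 - l),
    ⟨hpos, (div_le_one (by linarith)).mpr (by linarith)⟩, heq.ge⟩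
end

section
/- Let N, N_R be positive natural numbers with N_R divisible by 3, and let λ be a real number with 0 < λ ≤ 1. If N_R > (3/4)·N·(2−λ), then (1/(2−λ))·min(N, 2N_R/3) > min(N, N_R)/2. (That is, the RF-chain-conserved full-duplex relaying degrees of freedom exceed the half-duplex relaying degrees of freedom whenever the relay has more than (3/4)(2−λ)N antennas.) -/
/-- Symmetric two hop channel: the RF-chain-conserved full-duplex relaying DoF
(1/(2−λ))·min(N, 2N_R/3) exceeds the half-duplex relaying DoF min(N, N_R)/2
whenever the relay has more than (3/4)(2−λ)N antennas. -/
theorem stmt_14 (N N_R : ℕ) (hN : 0 < N) (hR : 0 < N_R) (h3 : 3 ∣ N_R)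
    (l : ℝ) (hl0 : 0 < l) (hl1 : l ≤ 1)
    (h : (N_R : ℝ) > (3 / 4) * (N : ℝ) * (2 - l)) :
    (1 / (2 - l)) * min (N : ℝ) (2 * (N_R : ℝ) / 3) > min (N : ℝ) (N_R : ℝ) / 2 := by
  have hNpos : (0 : ℝ) < N := by exact_mod_cast hN
  have hd : 0 < 2 - l := by linarith
  have key : (N : ℝ) / 2 < 1 / (2 - l) * min (N : ℝ) (2 * (N_R : ℝ) / 3) := by
    rw [one_div_mul_eq_div, lt_div_iff₀ hd]
    refine lt_min ?_ ?_
    · linarith [mul_pos hNpos hl0]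
    · linarith
  linarith [min_le_left (N : ℝ) (N_R : ℝ)]
end

section
/- Let N_R ≥ 2 and N_B ≥ 1 be natural numbers and let λ be a real number with 0 ≤ λ ≤ 1. Then the supremum over integers 1 ≤ r ≤ N_R−1 and reals γ ∈ (0,1] of min(1−γ(1−λ), (1−γ(1−λ))·r, γ·(N_R−r), γ·N_B) equals m/(m+1−λ), where m = min(N_R−1, N_B), and it is attained at r = 1 and γ = 1/(m+1−λ). -/
/-- A decreasing line `1 - γ * (1 - l)` and an increasing line `γ * m` never both exceed
the height `m / (m + 1 - l)` at which they cross. -/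
theorem min_one_sub_mul_le_div {m l : ℝ} (hm : 0 < m) (hl : 0 ≤ 1 - l) (γ : ℝ) :
    min (1 - γ * (1 - l)) (γ * m) ≤ m / (m + 1 - l) := by
  rw [le_div_iff₀ (by linarith)]
  have h₁ := mul_le_mul_of_nonneg_right (min_le_left (1 - γ * (1 - l)) (γ * m)) hm.le
  have h₂ := mul_le_mul_of_nonneg_right (min_le_right (1 - γ * (1 - l)) (γ * m)) hl
  linarith

/-- Asymmetric full-duplex two hop channel (single-antenna source): the supremum
over antenna splits r and power scalings γ ∈ (0,1] of
min(1−γ(1−λ), (1−γ(1−λ))r, γ(N_R−r), γN_B) equals m/(m+1−λ) with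
m = min(N_R−1, N_B), attained at r = 1 and γ = 1/(m+1−λ). -/
theorem stmt_15 (N_R N_B : ℕ) (hR : 2 ≤ N_R) (hB : 1 ≤ N_B)
    (l : ℝ) (hl0 : 0 ≤ l) (hl1 : l ≤ 1) :
    IsGreatest {x : ℝ | ∃ r : ℕ, 1 ≤ r ∧ r ≤ N_R - 1 ∧ ∃ γ ∈ Set.Ioc (0 : ℝ) 1,
        x = min (min (1 - γ * (1 - l)) ((1 - γ * (1 - l)) * r))
                (min (γ * ((N_R : ℝ) - r)) (γ * N_B))}
      (((min (N_R - 1) N_B : ℕ) : ℝ) / (((min (N_R - 1) N_B : ℕ) : ℝ) + 1 - l)) ∧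
    min (min (1 - (1 / (((min (N_R - 1) N_B : ℕ) : ℝ) + 1 - l)) * (1 - l))
             ((1 - (1 / (((min (N_R - 1) N_B : ℕ) : ℝ) + 1 - l)) * (1 - l)) * (1 : ℕ)))
        (min ((1 / (((min (N_R - 1) N_B : ℕ) : ℝ) + 1 - l)) * ((N_R : ℝ) - (1 : ℕ)))
             ((1 / (((min (N_R - 1) N_B : ℕ) : ℝ) + 1 - l)) * N_B))
      = ((min (N_R - 1) N_B : ℕ) : ℝ) / (((min (N_R - 1) N_B : ℕ) : ℝ) + 1 - l) := by
  have hm : ((min (N_R - 1) N_B : ℕ) : ℝ) = min ((N_R : ℝ) - 1) N_B := by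
    rw [Nat.cast_min, Nat.cast_sub (by omega), Nat.cast_one]
  have hm1 : (1 : ℝ) ≤ ((min (N_R - 1) N_B : ℕ) : ℝ) := by
    exact_mod_cast (by omega : 1 ≤ min (N_R - 1) N_B)
  generalize ((min (N_R - 1) N_B : ℕ) : ℝ) = m at hm hm1 ⊢
  have hd : 0 < m + 1 - l := by linarith
  have hγ : 0 < 1 / (m + 1 - l) := by positivity
  have hval : min (min (1 - 1 / (m + 1 - l) * (1 - l))
        ((1 - 1 / (m + 1 - l) * (1 - l)) * (1 : ℕ)))
      (min (1 / (m + 1 - l) * ((N_R : ℝ) - (1 : ℕ))) (1 / (m + 1 - l) * N_B))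
      = m / (m + 1 - l) := by
    rw [← mul_min_of_nonneg _ _ hγ.le, Nat.cast_one, mul_one, min_self, ← hm]
    have h : 1 - 1 / (m + 1 - l) * (1 - l) = m / (m + 1 - l) := by
      field_simp
      ring
    rw [h, one_div_mul_eq_div, min_self]
  refine ⟨⟨⟨1, le_rfl, by omega, _, ⟨hγ, ?_⟩, hval.symm⟩, ?_⟩, hval⟩
  · rw [div_le_one hd]
    linarith
  · rintro x ⟨r, hr, -, γ, ⟨hγ0, -⟩, rfl⟩
    rw [← mul_min_of_nonneg _ _ hγ0.le]
    exact (min_le_min (min_le_left _ _) (mul_le_mul_of_nonneg_left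
      (hm ▸ min_le_min_right _ (sub_le_sub_left (Nat.one_le_cast.mpr hr) _)) hγ0.le)).trans
      (min_one_sub_mul_le_div (by linarith) (by linarith) γ)
end

section
/- Let N_R ≥ 2 and N_B ≥ 1 be natural numbers, let λ be a real number with 0 ≤ λ ≤ 1, and set m = min(N_R−1, N_B) and m' = min(N_R, N_B). Then m/(m+1−λ) > m'/(m'+1) if and only if λ > 1 − m/m'. -/
/-- Asymmetric two hop channel: the full-duplex relaying DoF m/(m+1−λ), with
m = min(N_R−1, N_B), exceeds the half-duplex relaying DoF m'/(m'+1), with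
m' = min(N_R, N_B), if and only if λ > 1 − m/m'. -/
theorem stmt_17 (N_R N_B : ℕ) (hR : 2 ≤ N_R) (hB : 1 ≤ N_B)
    (l : ℝ) (hl0 : 0 ≤ l) (hl1 : l ≤ 1) :
    ((min (N_R - 1) N_B : ℕ) : ℝ) / (((min (N_R - 1) N_B : ℕ) : ℝ) + 1 - l)
        > ((min N_R N_B : ℕ) : ℝ) / (((min N_R N_B : ℕ) : ℝ) + 1)
      ↔ l > 1 - ((min (N_R - 1) N_B : ℕ) : ℝ) / ((min N_R N_B : ℕ) : ℝ) := by
  have hm : (0 : ℝ) < ((min (N_R - 1) N_B : ℕ) : ℝ) := by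
    exact_mod_cast (by omega : 0 < min (N_R - 1) N_B)
  have hm' : (0 : ℝ) < ((min N_R N_B : ℕ) : ℝ) := by
    exact_mod_cast (by omega : 0 < min N_R N_B)
  generalize ((min (N_R - 1) N_B : ℕ) : ℝ) = m at *
  generalize ((min N_R N_B : ℕ) : ℝ) = m' at *
  rw [gt_iff_lt, gt_iff_lt, div_lt_div_iff₀ (by linarith) (by linarith), sub_lt_comm,
    lt_div_iff₀ hm']
  constructor <;> intro h <;> linarith
end

section
/- Let N_R ≥ 2 and N_B ≥ 1 be natural numbers and let λ be a real number with 0 < λ ≤ 1, and set m = min(N_R−1, N_B) and m' = min(N_R, N_B). Then λ > 1 − m/m' if and only if N_R > min(N_B, 1/λ). (Hence full-duplex relaying outperforms half-duplex relaying in degrees of freedom exactly when the relay has more than min(N_B, 1/λ) antennas.) -/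
/-- Asymmetric two hop channel: with m = min(N_R−1, N_B) and m' = min(N_R, N_B),
the condition λ > 1 − m/m' holds if and only if N_R > min(N_B, 1/λ); i.e.
full-duplex relaying outperforms half-duplex relaying in DoF exactly when the
relay has more than min(N_B, 1/λ) antennas. -/
theorem stmt_18 (N_R N_B : ℕ) (hR : 2 ≤ N_R) (hB : 1 ≤ N_B)
    (l : ℝ) (hl0 : 0 < l) (hl1 : l ≤ 1) :
    l > 1 - ((min (N_R - 1) N_B : ℕ) : ℝ) / ((min N_R N_B : ℕ) : ℝ)
      ↔ (N_R : ℝ) > min (N_B : ℝ) (1 / l) := by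
  rcases lt_or_ge N_B N_R with h | h
  · have hB' : (N_B : ℝ) ≠ 0 := by positivity
    have hcast : (N_B : ℝ) < N_R := by exact_mod_cast h
    rw [min_eq_right (Nat.le_sub_one_of_lt h), min_eq_right h.le, div_self hB', sub_self]
    exact iff_of_true hl0 (min_lt_of_left_lt hcast)
  · have hR' : (0 : ℝ) < N_R := by positivity
    have hcast : (N_R : ℝ) ≤ N_B := by exact_mod_cast h
    have hm : 1 - ((N_R : ℝ) - 1) / N_R = 1 / N_R := by
      field_simp
      ring
    rw [min_eq_left ((Nat.sub_le _ _).trans h), min_eq_left h,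
      Nat.cast_sub (by lia), Nat.cast_one, hm, gt_iff_lt, gt_iff_lt, min_lt_iff,
      or_iff_right hcast.not_gt]
    exact one_div_lt hR' hl0
end
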